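/- For every alternating 4-linear form T on ℝ^n and all u, v, w, z ∈ ℝ^n, Tr( ĉ(u) ĉ(v) ĉ(w) ĉ(z) ∑_{1≤k<l<α<β≤n} T(e_k,e_l,e_α,e_β) ĉ(e_k) ĉ(e_l) ĉ(e_α) ĉ(e_β) ) = T(u,v,w,z) · 2^n. -/

import Mathlib

open MeasureTheory

noncomputable section

/-- Euclidean space `ℝ^n` with its standard inner product. -/
abbrev Eucl (n : ℕ) := EuclideanSpace ℝ (Fin n)

/-- The exterior algebra `Λℝ^n`. -/
abbrev ExtAlg (n : ℕ) := ExteriorAlgebra ℝ (Eucl n)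

/-- The standard orthonormal basis vector `e_i` of `ℝ^n`. -/
def e (n : ℕ) (i : Fin n) : Eucl n := EuclideanSpace.single i 1

/-- Left exterior multiplication `ε(x)` on `Λℝ^n`. -/
def eps {n : ℕ} (x : Eucl n) : Module.End ℝ (ExtAlg n) :=
  LinearMap.mulLeft ℝ (ExteriorAlgebra.ι ℝ x)

/-- Interior multiplication (contraction) `ι(x)` on `Λℝ^n`, determined by the inner product. -/
def iot {n : ℕ} (x : Eucl n) : Module.End ℝ (ExtAlg n) :=
  CliffordAlgebra.contractLeft (Q := (0 : QuadraticForm ℝ (Eucl n))) (innerSL ℝ x).toLinearMap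

/-- The Clifford action `c(x) = ε(x) − ι(x)`. -/
def c {n : ℕ} (x : Eucl n) : Module.End ℝ (ExtAlg n) := eps x - iot x

/-- The Clifford action `ĉ(x) = ε(x) + ι(x)`. -/
def hc {n : ℕ} (x : Eucl n) : Module.End ℝ (ExtAlg n) := eps x + iot x

/-- The trace of a linear endomorphism of `Λℝ^n`. -/
def Tr {n : ℕ} : Module.End ℝ (ExtAlg n) →ₗ[ℝ] ℝ := LinearMap.trace ℝ (ExtAlg n)

/-- `ĉ` satisfies the Clifford relation for the inner product. -/
lemma hc_mul_hc {n : ℕ} (x f : Eucl n) :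
    hc x * hc f = (2 * inner ℝ x f : ℝ) • (1 : Module.End ℝ (ExtAlg n)) - hc f * hc x := by
  refine LinearMap.ext fun y ↦ ?_
  have h := CliffordAlgebra.contractLeft_comm (Q := (0 : QuadraticForm ℝ (Eucl n)))
    (innerSL ℝ x).toLinearMap (d' := (innerSL ℝ f).toLinearMap) y
  have h1 (a b : Eucl n) (y : ExtAlg n) : iot a (ExteriorAlgebra.ι ℝ b * y)
      = (inner ℝ a b : ℝ) • y - ExteriorAlgebra.ι ℝ b * iot a y :=
    CliffordAlgebra.contractLeft_ι_mul (Q := (0 : QuadraticForm ℝ (Eucl n))) _ b y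
  have h2 : iot x (iot f y) = - iot f (iot x y) := h
  have h3 : ExteriorAlgebra.ι ℝ x * (ExteriorAlgebra.ι ℝ f * y)
      = - (ExteriorAlgebra.ι ℝ f * (ExteriorAlgebra.ι ℝ x * y)) := by
    rw [← mul_assoc, ← mul_assoc, ← neg_mul]
    congr 1
    exact eq_neg_of_add_eq_zero_left (ExteriorAlgebra.ι_add_mul_swap x f)
  simp only [hc, eps, Module.End.mul_apply, LinearMap.add_apply, LinearMap.sub_apply,
    LinearMap.smul_apply, Module.End.one_apply, LinearMap.mulLeft_apply, h1, h2, h3, mul_add,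
    real_inner_comm x f]
  module

lemma Tr_mul_comm {n : ℕ} (A B : Module.End ℝ (ExtAlg n)) : Tr (A * B) = Tr (B * A) :=
  LinearMap.trace_mul_comm ℝ A B

lemma Tr_one (n : ℕ) : Tr (1 : Module.End ℝ (ExtAlg n)) = 2 ^ n := by
  let b := (EuclideanSpace.basisFun (Fin n) ℝ).toBasis.ExteriorAlgebra
  have := Module.Finite.of_basis b
  have := Module.Free.of_basis b
  rw [Tr, LinearMap.trace_one, Module.finrank_eq_card_basis b]
  simp

section CliffordTrace

/-! Traces of products of elements of an algebra satisfying the Clifford relation. -/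

variable {V A : Type*} [NormedAddCommGroup V] [InnerProductSpace ℝ V] [Ring A] [Algebra ℝ A]
  {γ : V → A} {t : A →ₗ[ℝ] ℝ}

lemma clifford_mul (hγ : ∀ x y, γ x * γ y = (2 * inner ℝ x y : ℝ) • (1 : A) - γ y * γ x)
    (x f : V) (P : A) : γ x * (γ f * P) = (2 * inner ℝ x f : ℝ) • P - γ f * (γ x * P) := by
  rw [← mul_assoc, hγ, sub_mul, smul_mul_assoc, one_mul, mul_assoc]

lemma trace_two
    (hγ : ∀ x y, γ x * γ y = (2 * inner ℝ x y : ℝ) • (1 : A) - γ y * γ x)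
    (ht : ∀ a b, t (a * b) = t (b * a))
    (u f : V) : t (γ u * γ f) = inner ℝ u f * t 1 := by
  have h := congrArg t (hγ u f)
  rw [map_sub, map_smul, ht (γ f), smul_eq_mul] at h
  linarith

lemma trace_two_mul
    (hγ : ∀ x y, γ x * γ y = (2 * inner ℝ x y : ℝ) • (1 : A) - γ y * γ x)
    (ht : ∀ a b, t (a * b) = t (b * a))
    (u v f : V) {X : A} (hX : X * γ f = -(γ f * X)) :
    t (γ u * (γ v * (X * γ f)))
      = inner ℝ u f * t (γ v * X) - inner ℝ v f * t (γ u * X) := by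
  have hcyc := ht (γ f) (γ u * (γ v * X))
  simp only [mul_assoc] at hcyc
  have h := congrArg (fun Y ↦ t (γ u * (γ v * Y))) hX
  simp only [mul_neg, clifford_mul hγ _ f, mul_sub, mul_smul_comm, map_neg, map_sub, map_smul,
    smul_eq_mul] at h
  linarith

lemma trace_three_mul
    (hγ : ∀ x y, γ x * γ y = (2 * inner ℝ x y : ℝ) • (1 : A) - γ y * γ x)
    (ht : ∀ a b, t (a * b) = t (b * a))
    (u v w f : V) {X : A} (hX : X * γ f = γ f * X) :
    t (γ u * (γ v * (γ w * (X * γ f))))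
      = inner ℝ u f * t (γ v * (γ w * X)) - inner ℝ v f * t (γ u * (γ w * X))
        + inner ℝ w f * t (γ u * (γ v * X)) := by
  have hcyc := ht (γ f) (γ u * (γ v * (γ w * X)))
  simp only [mul_assoc] at hcyc
  have h := congrArg (fun Y ↦ t (γ u * (γ v * (γ w * Y)))) hX
  simp only [clifford_mul hγ _ f, mul_sub, mul_smul_comm, map_sub, map_smul, smul_eq_mul] at h
  linarith

lemma trace_four_mul
    (hγ : ∀ x y, γ x * γ y = (2 * inner ℝ x y : ℝ) • (1 : A) - γ y * γ x)
    (ht : ∀ a b, t (a * b) = t (b * a))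
    (u v w z f : V) {X : A} (hX : X * γ f = -(γ f * X)) :
    t (γ u * (γ v * (γ w * (γ z * (X * γ f)))))
      = inner ℝ u f * t (γ v * (γ w * (γ z * X)))
        - inner ℝ v f * t (γ u * (γ w * (γ z * X)))
        + inner ℝ w f * t (γ u * (γ v * (γ z * X)))
        - inner ℝ z f * t (γ u * (γ v * (γ w * X))) := by
  have hcyc := ht (γ f) (γ u * (γ v * (γ w * (γ z * X))))
  simp only [mul_assoc] at hcyc
  have h := congrArg (fun Y ↦ t (γ u * (γ v * (γ w * (γ z * Y))))) hX
  simp only [mul_neg, clifford_mul hγ _ f, mul_sub, mul_smul_comm, map_neg, map_sub, map_smul,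
    smul_eq_mul] at h
  linarith

/-- The trace of eight Clifford factors, the last four of which are pairwise orthogonal, is a Gram
determinant. -/
lemma trace_eight
    (hγ : ∀ x y, γ x * γ y = (2 * inner ℝ x y : ℝ) • (1 : A) - γ y * γ x)
    (ht : ∀ a b, t (a * b) = t (b * a))
    (u v w z : V) (f : Fin 4 → V)
    (hf : Pairwise fun i j ↦ inner ℝ (f i) (f j) = 0) :
    t (γ u * γ v * γ w * γ z * (γ (f 0) * γ (f 1) * γ (f 2) * γ (f 3)))
      = Matrix.det (.of fun i j ↦ inner ℝ (![u, v, w, z] i) (f j)) * t 1 := by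
  have hac {i j : Fin 4} (hij : i ≠ j) : γ (f i) * γ (f j) = -(γ (f j) * γ (f i)) :=
    by simp [hγ (f i), hf hij]
  have h1 : γ (f 0) * γ (f 1) = -(γ (f 1) * γ (f 0)) := hac (by decide)
  have h2 : γ (f 0) * γ (f 1) * γ (f 2) = γ (f 2) * (γ (f 0) * γ (f 1)) := by
    rw [mul_assoc, hac (i := 1) (j := 2) (by decide), mul_neg, ← mul_assoc,
      hac (i := 0) (j := 2) (by decide), neg_mul, neg_neg, mul_assoc]
  have h3 : γ (f 0) * γ (f 1) * γ (f 2) * γ (f 3)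
      = -(γ (f 3) * (γ (f 0) * γ (f 1) * γ (f 2))) := by
    rw [mul_assoc, hac (i := 2) (j := 3) (by decide), mul_neg, ← mul_assoc,
      mul_assoc (γ (f 0)), hac (i := 1) (j := 3) (by decide), mul_neg, ← mul_assoc,
      hac (i := 0) (j := 3) (by decide)]
    simp only [neg_mul, neg_neg, mul_assoc]
  rw [mul_assoc, mul_assoc, mul_assoc, trace_four_mul hγ ht _ _ _ _ _ h3]
  simp only [trace_three_mul hγ ht _ _ _ _ h2, trace_two_mul hγ ht _ _ _ h1, trace_two hγ ht]
  simp [Matrix.det_succ_row_zero, Fin.sum_univ_succ, Fin.succAbove]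
  ring

end CliffordTrace

lemma det_ite_eq_of_strictMono {m n : ℕ} {v κ : Fin m → Fin n} (hv : StrictMono v)
    (hκ : StrictMono κ) :
    Matrix.det (.of fun i j ↦ if κ j = v i then (1 : ℝ) else 0) = if κ = v then 1 else 0 := by
  split_ifs with h
  · subst h
    convert Matrix.det_one (n := Fin m) (R := ℝ)
    ext i j
    simp [Matrix.one_apply, hκ.injective.eq_iff, eq_comm]
  · rw [Matrix.det_apply]
    refine Finset.sum_eq_zero fun σ _ ↦ ?_
    obtain ⟨i, hi⟩ : ∃ i, κ i ≠ v (σ i) := by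
      by_contra! hall
      refine h ((hκ.range_inj hv).1 ?_)
      rw [show κ = v ∘ σ from funext hall, σ.surjective.range_comp]
    rw [Finset.prod_eq_zero (Finset.mem_univ i) (by simp [hi]), smul_zero]

/-- Two alternating forms agreeing on increasing tuples of basis vectors are equal. -/
lemma AlternatingMap.ext_of_strictMono {m n : ℕ} {R M N : Type*} [CommRing R] [AddCommGroup M]
    [Module R M] [AddCommGroup N] [Module R N] (b : Module.Basis (Fin n) R M)
    {A B : M [⋀^Fin m]→ₗ[R] N}
    (h : ∀ v : Fin m → Fin n, StrictMono v → A (b ∘ v) = B (b ∘ v)) : A = B := by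
  refine Module.Basis.ext_alternating b fun v hv ↦ ?_
  have hs : StrictMono (v ∘ Tuple.sort v) :=
    (Tuple.monotone_sort v).strictMono_of_injective (hv.comp (Tuple.sort v).injective)
  have := h _ hs
  rw [← Function.comp_assoc, A.map_perm, B.map_perm] at this
  exact smul_left_cancel _ this

lemma inner_e_right {n : ℕ} (x : Eucl n) (i : Fin n) : inner ℝ x (e n i) = x i := by
  rw [e, EuclideanSpace.inner_single_right]
  simp

/-- The alternating form taking the minor with columns `κ` of a tuple of vectors. -/
def minorForm {m n : ℕ} (κ : Fin m → Fin n) : Eucl n [⋀^Fin m]→ₗ[ℝ] ℝ :=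
  Matrix.detRowAlternating.compLinearMap
    (LinearMap.pi fun j ↦ (EuclideanSpace.proj (κ j) : Eucl n →L[ℝ] ℝ).toLinearMap)

lemma minorForm_apply {m n : ℕ} (κ : Fin m → Fin n) (v : Fin m → Eucl n) :
    minorForm κ v = Matrix.det (.of fun i j ↦ v i (κ j)) := rfl

lemma AlternatingMap.finset_sum_apply {R M N ι κ : Type*} [Semiring R] [AddCommMonoid M]
    [Module R M] [AddCommMonoid N] [Module R N] (s : Finset κ) (f : κ → M [⋀^ι]→ₗ[R] N)
    (v : ι → M) : (∑ k ∈ s, f k) v = ∑ k ∈ s, f k v := by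
  classical
  induction s using Finset.induction_on with
  | empty => simp
  | insert k s hk ih => simp [Finset.sum_insert hk, ih]

/-- Expansion of an alternating `4`-form in terms of its values on increasing tuples of standard
basis vectors. -/
lemma sum_smul_minorForm {n : ℕ} (T : Eucl n [⋀^Fin 4]→ₗ[ℝ] ℝ) :
    (∑ k : Fin n, ∑ l : Fin n, ∑ a : Fin n, ∑ b : Fin n,
      if k < l ∧ l < a ∧ a < b then
        T ![e n k, e n l, e n a, e n b] • minorForm ![k, l, a, b] else 0) = T := by
  refine AlternatingMap.ext_of_strictMono (EuclideanSpace.basisFun (Fin n) ℝ).toBasis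
    fun v hv ↦ ?_
  have hb : ⇑(EuclideanSpace.basisFun (Fin n) ℝ).toBasis ∘ v = fun i ↦ e n (v i) := by
    ext1 i
    simp [e]
  have hterm (k l a b : Fin n) :
      (if k < l ∧ l < a ∧ a < b then
        T ![e n k, e n l, e n a, e n b] • minorForm ![k, l, a, b] else 0) (fun i ↦ e n (v i))
      = if k = v 0 then if l = v 1 then if a = v 2 then if b = v 3 then
          T (fun i ↦ e n (v i)) else 0 else 0 else 0 else 0 := by
    have heq : ![k, l, a, b] = v ↔ k = v 0 ∧ l = v 1 ∧ a = v 2 ∧ b = v 3 := by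
      simp [funext_iff, Fin.forall_fin_succ]
    simp only [← ite_and, ← heq]
    by_cases hlt : k < l ∧ l < a ∧ a < b
    · have hκ : StrictMono ![k, l, a, b] := by
        rw [Fin.strictMono_iff_lt_succ]
        simpa [Fin.forall_fin_succ] using hlt
      have hdet := det_ite_eq_of_strictMono hv hκ
      rw [if_pos hlt, AlternatingMap.smul_apply, minorForm_apply]
      simp only [e, EuclideanSpace.single, PiLp.single_apply, hdet]
      split_ifs with h
      · subst h
        simp only [smul_eq_mul, mul_one]
        congr 1
        ext1 i
        fin_cases i <;> rfl
      · simp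
    · rw [if_neg hlt, if_neg, AlternatingMap.zero_apply]
      rintro rfl
      exact hlt ⟨hv (show (0 : Fin 4) < 1 by decide), hv (show (1 : Fin 4) < 2 by decide),
        hv (show (2 : Fin 4) < 3 by decide)⟩
  simp only [hb, AlternatingMap.finset_sum_apply, hterm]
  simp

theorem stmt_16 (n : ℕ) (hn : 0 < n) (T : Eucl n [⋀^Fin 4]→ₗ[ℝ] ℝ) (u v w z : Eucl n) :
    Tr (hc u * hc v * hc w * hc z * ∑ k : Fin n, ∑ l : Fin n, ∑ a : Fin n, ∑ b : Fin n,
        if k < l ∧ l < a ∧ a < b then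
          T ![e n k, e n l, e n a, e n b] •
            (hc (e n k) * hc (e n l) * hc (e n a) * hc (e n b)) else 0)
      = T ![u, v, w, z] * 2 ^ n := by
  conv_rhs => rw [← sum_smul_minorForm T]
  simp only [AlternatingMap.finset_sum_apply, Finset.mul_sum, map_sum, Finset.sum_mul]
  refine Finset.sum_congr rfl fun k _ ↦ Finset.sum_congr rfl fun l _ ↦
    Finset.sum_congr rfl fun a _ ↦ Finset.sum_congr rfl fun b _ ↦ ?_
  split_ifs with h
  · have hκ : StrictMono ![k, l, a, b] := by
      rw [Fin.strictMono_iff_lt_succ]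
      simpa [Fin.forall_fin_succ] using h
    have htr := trace_eight (γ := hc) hc_mul_hc Tr_mul_comm u v w z
      (fun j ↦ e n (![k, l, a, b] j)) fun i j hij ↦ by
        beta_reduce
        rw [inner_e_right, e, EuclideanSpace.single, PiLp.single_apply,
          if_neg (hκ.injective.ne hij.symm)]
    simp only [inner_e_right, ← minorForm_apply, Tr_one] at htr
    rw [mul_smul_comm, map_smul, AlternatingMap.smul_apply, smul_eq_mul, smul_eq_mul,
      mul_assoc (T _)]
    exact congrArg _ htr
  · simp
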